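/- arXiv:1511.05412 — 2 statements merged into one kernel-verified Lean document; each statement's English description precedes it below -/
import Mathlib

section
/- Let x_{(r)} = Σ_{w ∈ S_r} T_w in the Hecke-Clifford superalgebra H^c_{r,R}, and let c_{q,r} = q^{r-1} c_1 + q^{r-2} c_2 + ··· + c_r and c'_{q,r} = c_1 + q c_2 + ··· + q^{r-1} c_r. Then x_{(r)} c_{q,r} = c'_{q,r} x_{(r)}. -/
namespace HCPaper

noncomputable section

open MulOpposite

/-- Generators of the Hecke-Clifford superalgebra: `Sum.inl i` is `T_{i+1}` (0-based `i < r-1`),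
`Sum.inr j` is `c_{j+1}` (0-based `j < r`). -/
abbrev Gen (r : ℕ) := (Fin (r - 1)) ⊕ (Fin r)

/-- The index `i` viewed in `Fin r` (the first of the two indices moved by `T_i`). -/
def loIdx {r : ℕ} (i : Fin (r - 1)) : Fin r := ⟨i.val, by have := i.isLt; omega⟩

/-- The index `i+1` viewed in `Fin r`. -/
def hiIdx {r : ℕ} (i : Fin (r - 1)) : Fin r := ⟨i.val + 1, by have := i.isLt; omega⟩

def Tf (R : Type) [CommRing R] (r : ℕ) (i : Fin (r - 1)) : FreeAlgebra R (Gen r) :=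
  FreeAlgebra.ι R (Sum.inl i)

def Cf (R : Type) [CommRing R] (r : ℕ) (j : Fin r) : FreeAlgebra R (Gen r) :=
  FreeAlgebra.ι R (Sum.inr j)

/-- The defining relations of the Hecke-Clifford superalgebra `H^c_{r,R}`. -/
inductive HCRel (R : Type) [CommRing R] (q : R) (r : ℕ) :
    FreeAlgebra R (Gen r) → FreeAlgebra R (Gen r) → Prop
  | csq (j : Fin r) : HCRel R q r (Cf R r j * Cf R r j) (-1)
  | canti (i j : Fin r) (h : i ≠ j) :
      HCRel R q r (Cf R r i * Cf R r j) (-(Cf R r j * Cf R r i))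
  | quad (i : Fin (r - 1)) :
      HCRel R q r ((Tf R r i - algebraMap R _ q) * (Tf R r i + 1)) 0
  | commTT (i i' : Fin (r - 1)) (h : i.val + 1 < i'.val) :
      HCRel R q r (Tf R r i * Tf R r i') (Tf R r i' * Tf R r i)
  | braid (i i' : Fin (r - 1)) (h : i'.val = i.val + 1) :
      HCRel R q r (Tf R r i * Tf R r i' * Tf R r i) (Tf R r i' * Tf R r i * Tf R r i')
  | commTC (i : Fin (r - 1)) (j : Fin r) (h1 : j.val ≠ i.val) (h2 : j.val ≠ i.val + 1) :
      HCRel R q r (Tf R r i * Cf R r j) (Cf R r j * Tf R r i)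
  | TClo (i : Fin (r - 1)) :
      HCRel R q r (Tf R r i * Cf R r (loIdx i)) (Cf R r (hiIdx i) * Tf R r i)
  | TChi (i : Fin (r - 1)) :
      HCRel R q r (Tf R r i * Cf R r (hiIdx i))
        (Cf R r (loIdx i) * Tf R r i -
          algebraMap R _ (q - 1) * (Cf R r (loIdx i) - Cf R r (hiIdx i)))

/-- The Hecke-Clifford superalgebra `H^c_{r,R}` with parameter `q`, as a quotient of
the free algebra by the defining relations. -/
abbrev HC (R : Type) [CommRing R] (q : R) (r : ℕ) := RingQuot (HCRel R q r)

/-- The generator `T_{i+1}` of `H^c_{r,R}` (0-based index). -/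
def TT (R : Type) [CommRing R] (q : R) (r : ℕ) (i : Fin (r - 1)) : HC R q r :=
  RingQuot.mkAlgHom R (HCRel R q r) (Tf R r i)

/-- The generator `c_{j+1}` of `H^c_{r,R}` (0-based index). -/
def CC (R : Type) [CommRing R] (q : R) (r : ℕ) (j : Fin r) : HC R q r :=
  RingQuot.mkAlgHom R (HCRel R q r) (Cf R r j)

end

end HCPaper
namespace HCPaper

/-- The Coxeter length of a permutation of `Fin r`: its number of inversions. -/
def len {r : ℕ} (w : Equiv.Perm (Fin r)) : ℕ :=
  (Finset.univ.filter fun p : Fin r × Fin r => p.1 < p.2 ∧ w p.2 < w p.1).card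

/-- The simple transposition `s_{k+1} = (k+1, k+2)` (0-based `k < r-1`) as a permutation. -/
def simpleT {r : ℕ} (k : Fin (r - 1)) : Equiv.Perm (Fin r) :=
  Equiv.swap (loIdx k) (hiIdx k)

/-- Partial sum `λ_1 + ⋯ + λ_k` of a composition. -/
def psum {n : ℕ} (lam : Fin n → ℕ) (k : ℕ) : ℕ :=
  ∑ i : Fin n, if (i : ℕ) < k then lam i else 0

/-- `j` (0-based) lies in the `k`-th block `R^λ_{k+1}` of the composition `λ`. -/
def InBlock {n r : ℕ} (lam : Fin n → ℕ) (k : Fin n) (j : Fin r) : Prop :=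
  psum lam (k : ℕ) ≤ (j : ℕ) ∧ (j : ℕ) < psum lam (k : ℕ) + lam k

instance {n r : ℕ} (lam : Fin n → ℕ) (k : Fin n) (j : Fin r) : Decidable (InBlock lam k j) := by
  unfold InBlock; infer_instance

/-- Membership in the Young subgroup `S_λ`: `w` preserves each block of `λ`. -/
def MemYoung {n r : ℕ} (lam : Fin n → ℕ) (w : Equiv.Perm (Fin r)) : Prop :=
  ∀ (k : Fin n) (j : Fin r), InBlock lam k j → InBlock lam k (w j)

instance {n r : ℕ} (lam : Fin n → ℕ) (w : Equiv.Perm (Fin r)) : Decidable (MemYoung lam w) := by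
  unfold MemYoung; infer_instance

/-- `d` is the minimal length element of the double coset `S_λ d S_μ`. -/
def MinDouble {r n1 n2 : ℕ} (lam : Fin n1 → ℕ) (mu : Fin n2 → ℕ) (d : Equiv.Perm (Fin r)) :
    Prop :=
  ∀ u σ : Equiv.Perm (Fin r), MemYoung lam u → MemYoung mu σ → len d ≤ len (u * d * σ)

end HCPaper
namespace HCPaper

noncomputable section

/-- `TW` is the standard basis `w ↦ T_w` of the Hecke subalgebra of `H^c_{r,R}`:
`T_1 = 1` and `T_{w s_k} = T_w T_{s_k}` whenever `ℓ(w s_k) = ℓ(w) + 1`. -/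
def IsTW {R : Type} [CommRing R] (q : R) (r : ℕ) (TW : Equiv.Perm (Fin r) → HC R q r) :
    Prop :=
  TW 1 = 1 ∧ ∀ (w : Equiv.Perm (Fin r)) (k : Fin (r - 1)),
    len (w * simpleT k) = len w + 1 → TW (w * simpleT k) = TW w * TT R q r k

/-- The element `x_λ = ∑_{w ∈ S_λ} T_w` of `H^c_{r,R}`. -/
def xElt {R : Type} [CommRing R] {q : R} {r n : ℕ} (lam : Fin n → ℕ)
    (TW : Equiv.Perm (Fin r) → HC R q r) : HC R q r :=
  ∑ w : Equiv.Perm (Fin r), if MemYoung lam w then TW w else 0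

/-- The element `c_{q,r} = q^{r-1} c_1 + q^{r-2} c_2 + ⋯ + c_r` of `H^c_{r,R}`. -/
def cqr (R : Type) [CommRing R] (q : R) (r : ℕ) : HC R q r :=
  ∑ j : Fin r, q ^ (r - 1 - (j : ℕ)) • CC R q r j

/-- The element `c'_{q,r} = c_1 + q c_2 + ⋯ + q^{r-1} c_r` of `H^c_{r,R}`. -/
def cqr' (R : Type) [CommRing R] (q : R) (r : ℕ) : HC R q r :=
  ∑ j : Fin r, q ^ (j : ℕ) • CC R q r j

end

end HCPaper

namespace HCPaper

section helpers

variable {R : Type} [CommRing R] {q : R} {n : ℕ}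

theorem simpleT_lo (k : Fin n) : simpleT (r := n + 1) k k.castSucc = k.succ :=
  Equiv.swap_apply_left _ _

theorem simpleT_hi (k : Fin n) : simpleT (r := n + 1) k k.succ = k.castSucc :=
  Equiv.swap_apply_right _ _

theorem simpleT_sq {r : ℕ} (k : Fin (r - 1)) : simpleT (r := r) k * simpleT k = 1 :=
  Equiv.swap_mul_self _ _

theorem simpleT_inv {r : ℕ} (k : Fin (r - 1)) : (simpleT (r := r) k)⁻¹ = simpleT k :=
  Equiv.swap_inv _ _

theorem simpleT_val (k : Fin n) (a : Fin (n + 1)) :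
    (simpleT (r := n + 1) k a).val =
      if a.val = k.val then k.val + 1 else if a.val = k.val + 1 then k.val else a.val := by
  unfold simpleT
  rw [Equiv.swap_apply_def]
  simp only [Fin.ext_iff, loIdx, hiIdx]
  split_ifs <;> rfl

theorem simpleT_lt (k : Fin n) (a b : Fin (n + 1)) (hab : a < b)
    (h : ¬ (a = k.castSucc ∧ b = k.succ)) :
    simpleT (r := n + 1) k a < simpleT (r := n + 1) k b := by
  rw [Fin.lt_def] at *
  simp only [Fin.ext_iff, Fin.val_castSucc, Fin.val_succ] at h
  rw [simpleT_val, simpleT_val]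
  split_ifs <;> omega

theorem simpleT_app (k : Fin n) (a : Fin (n + 1)) :
    simpleT (r := n + 1) k (simpleT (r := n + 1) k a) = a :=
  Equiv.swap_apply_self _ _ _

theorem len_up (w : Equiv.Perm (Fin (n + 1))) (k : Fin n) (h : w k.castSucc < w k.succ) :
    len (w * simpleT (r := n + 1) k) = len w + 1 := by
  unfold len
  have hs : (Finset.univ.filter fun p : Fin (n + 1) × Fin (n + 1) =>
      p.1 < p.2 ∧ (w * simpleT (r := n + 1) k) p.2 < (w * simpleT (r := n + 1) k) p.1) =
      insert (k.castSucc, k.succ)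
        ((Finset.univ.filter fun p : Fin (n + 1) × Fin (n + 1) => p.1 < p.2 ∧ w p.2 < w p.1).image
          (fun p => (simpleT (r := n + 1) k p.1, simpleT (r := n + 1) k p.2))) := by
    ext ⟨a, b⟩
    simp only [Finset.mem_filter, Finset.mem_univ, true_and, Finset.mem_insert, Finset.mem_image,
      Prod.mk.injEq, Prod.exists]
    rw [Equiv.Perm.mul_apply, Equiv.Perm.mul_apply]
    constructor
    · rintro ⟨h1, h2⟩
      by_cases hk : a = k.castSucc ∧ b = k.succ
      · exact Or.inl hk
      · exact Or.inr ⟨_, _, ⟨simpleT_lt k a b h1 hk, h2⟩, simpleT_app k a, simpleT_app k b⟩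
    · rintro (⟨rfl, rfl⟩ | ⟨a', b', ⟨h1, h2⟩, rfl, rfl⟩)
      · rw [simpleT_lo, simpleT_hi]
        exact ⟨Fin.castSucc_lt_succ, h⟩
      · rw [simpleT_app, simpleT_app]
        refine ⟨simpleT_lt k a' b' h1 ?_, h2⟩
        rintro ⟨rfl, rfl⟩
        exact absurd h h2.asymm
  rw [hs, Finset.card_insert_of_notMem, Finset.card_image_of_injective]
  · rintro ⟨a, b⟩ ⟨c, d⟩ he
    simp only [Prod.mk.injEq, EmbeddingLike.apply_eq_iff_eq] at he
    simp [he.1, he.2]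
  · simp only [Finset.mem_image, Finset.mem_filter, Finset.mem_univ, true_and, Prod.mk.injEq,
      Prod.exists, not_exists]
    rintro a b ⟨⟨h1, h2⟩, ha, hb⟩
    have ha' := simpleT_app k a
    have hb' := simpleT_app k b
    rw [ha, simpleT_lo] at ha'
    rw [hb, simpleT_hi] at hb'
    rw [← ha', ← hb'] at h1
    exact absurd h1 Fin.castSucc_lt_succ.asymm

theorem len_down (w : Equiv.Perm (Fin (n + 1))) (k : Fin n) (h : w k.succ < w k.castSucc) :
    len w = len (w * simpleT (r := n + 1) k) + 1 := by
  have := len_up (w * simpleT (r := n + 1) k) k (by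
    rw [Equiv.Perm.mul_apply, Equiv.Perm.mul_apply, simpleT_lo, simpleT_hi]; exact h)
  rwa [mul_assoc, simpleT_sq, mul_one] at this

theorem len_inv {r : ℕ} (w : Equiv.Perm (Fin r)) : len w⁻¹ = len w := by
  unfold len
  refine Finset.card_bij' (fun p _ => (w⁻¹ p.2, w⁻¹ p.1)) (fun p _ => (w p.2, w p.1)) ?_ ?_ ?_ ?_
  · rintro ⟨a, b⟩ h
    simpa [and_comm] using h
  · rintro ⟨a, b⟩ h
    simpa [and_comm] using h
  · rintro ⟨a, b⟩ h
    simp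
  · rintro ⟨a, b⟩ h
    simp

theorem len_left (w : Equiv.Perm (Fin (n + 1))) (k : Fin n) :
    len (simpleT (r := n + 1) k * w) = len (w⁻¹ * simpleT (r := n + 1) k) := by
  rw [← len_inv, mul_inv_rev, simpleT_inv]

theorem ne_vals (w : Equiv.Perm (Fin (n + 1))) (k : Fin n) : w k.castSucc ≠ w k.succ := by
  intro h
  exact absurd (w.injective h) Fin.castSucc_lt_succ.ne

theorem len_right_cases (w : Equiv.Perm (Fin (n + 1))) (k : Fin n) :
    len (w * simpleT (r := n + 1) k) = len w + 1 ∨ len w = len (w * simpleT (r := n + 1) k) + 1 := by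
  rcases lt_or_gt_of_ne (ne_vals w k) with h | h
  · exact Or.inl (len_up w k h)
  · exact Or.inr (len_down w k h)

theorem exists_descent (w : Equiv.Perm (Fin (n + 1))) (hw : w ≠ 1) :
    ∃ k : Fin n, w k.succ < w k.castSucc := by
  by_contra! h
  apply hw
  have hm : StrictMono w := Fin.strictMono_iff_lt_succ.2
    fun k => lt_of_le_of_ne (h k) (ne_vals w k)
  have := (StrictMono.range_inj hm strictMono_id).1 (by rw [w.surjective.range_eq, Set.range_id])
  ext x
  simp [this]

theorem sub_one_smul' {r : ℕ} (a : HC R q r) : (q - 1) • a = q • a - a := by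
  have h : (q - 1) • a + a = q • a := by
    conv_lhs => rw [← one_smul R a, smul_smul, mul_one, ← add_smul, sub_add_cancel]
  rw [← h, add_sub_cancel_right]

theorem T_quad (k : Fin n) :
    TT R q (n + 1) k * TT R q (n + 1) k = (q - 1) • TT R q (n + 1) k + q • 1 := by
  have := RingQuot.mkAlgHom_rel R (HCRel.quad (R := R) (q := q) (r := n + 1) k)
  simp only [map_mul, map_sub, map_add, map_one, map_zero, AlgHom.commutes] at this
  change (TT R q (n + 1) k - _) * (TT R q (n + 1) k + 1) = 0 at this
  rw [Algebra.algebraMap_eq_smul_one] at this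
  simp only [sub_mul, mul_add, smul_mul_assoc, one_mul, mul_one] at this
  rw [sub_one_smul', ← sub_eq_zero, ← this]
  abel

theorem T_comm (k : Fin n) (j : Fin (n + 1)) (h1 : j ≠ k.castSucc) (h2 : j ≠ k.succ) :
    TT R q (n + 1) k * CC R q (n + 1) j = CC R q (n + 1) j * TT R q (n + 1) k := by
  have := RingQuot.mkAlgHom_rel R (HCRel.commTC (R := R) (q := q) (r := n + 1) k j
    (fun h => h1 (Fin.ext h)) (fun h => h2 (Fin.ext h)))
  rw [map_mul, map_mul] at this
  exact this

theorem T_lo (k : Fin n) :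
    TT R q (n + 1) k * CC R q (n + 1) k.castSucc = CC R q (n + 1) k.succ * TT R q (n + 1) k := by
  have := RingQuot.mkAlgHom_rel R (HCRel.TClo (R := R) (q := q) (r := n + 1) k)
  rw [map_mul, map_mul] at this
  exact this

theorem T_hi (k : Fin n) :
    TT R q (n + 1) k * CC R q (n + 1) k.succ = CC R q (n + 1) k.castSucc * TT R q (n + 1) k
      - (q - 1) • (CC R q (n + 1) k.castSucc - CC R q (n + 1) k.succ) := by
  have := RingQuot.mkAlgHom_rel R (HCRel.TChi (R := R) (q := q) (r := n + 1) k)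
  simp only [map_mul, map_sub (RingQuot.mkAlgHom R _), AlgHom.commutes] at this
  rw [← Algebra.smul_def] at this
  exact this

variable {TW : Equiv.Perm (Fin (n + 1)) → HC R q (n + 1)}

theorem TW_right (hTW : IsTW q (n + 1) TW) (w : Equiv.Perm (Fin (n + 1))) (k : Fin n)
    (h : w k.castSucc < w k.succ) :
    TW (w * simpleT (r := n + 1) k) = TW w * TT R q (n + 1) k :=
  hTW.2 w k (len_up w k h)

theorem exists_factor (hTW : IsTW q (n + 1) TW) (w : Equiv.Perm (Fin (n + 1))) (hw : w ≠ 1) :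
    ∃ (v : Equiv.Perm (Fin (n + 1))) (k : Fin n), w k.succ < w k.castSucc ∧
      w = v * simpleT (r := n + 1) k ∧ len w = len v + 1 ∧ TW w = TW v * TT R q (n + 1) k := by
  obtain ⟨k, hk⟩ := exists_descent w hw
  have e : w = (w * simpleT (r := n + 1) k) * simpleT (r := n + 1) k := by
    rw [mul_assoc, simpleT_sq, mul_one]
  refine ⟨w * simpleT (r := n + 1) k, k, hk, e, len_down w k hk, ?_⟩
  have := hTW.2 (w * simpleT (r := n + 1) k) k (by rw [← e]; exact len_down w k hk)
  rwa [← e] at this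

theorem TW_left_aux (hTW : IsTW q (n + 1) TW) (k : Fin n) (m : ℕ) :
    ∀ w : Equiv.Perm (Fin (n + 1)), len w = m →
      len (simpleT (r := n + 1) k * w) = len w + 1 →
      TW (simpleT (r := n + 1) k * w) = TT R q (n + 1) k * TW w := by
  induction m using Nat.strong_induction_on with
  | _ m ih =>
    intro w hm hl
    by_cases hw : w = 1
    · subst hw
      have := hTW.2 1 k (by rw [one_mul]; rwa [mul_one] at hl)
      rw [one_mul] at this
      rw [mul_one, this, hTW.1, one_mul, mul_one]
    · obtain ⟨v, j, -, e, hlen, hT⟩ := exists_factor hTW w hw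
      have h1 := len_right_cases (simpleT (r := n + 1) k * v) j
      rw [mul_assoc, ← e] at h1
      have h2 := len_right_cases v⁻¹ k
      rw [← len_left, len_inv] at h2
      have h3 : len (simpleT (r := n + 1) k * v) = len v + 1 := by omega
      have h4 := ih (len v) (by omega) v rfl h3
      have h5 := hTW.2 (simpleT (r := n + 1) k * v) j (by rw [mul_assoc, ← e]; omega)
      rw [mul_assoc, ← e] at h5
      rw [h5, h4, hT, mul_assoc]

theorem TW_left (hTW : IsTW q (n + 1) TW) (w : Equiv.Perm (Fin (n + 1))) (k : Fin n)
    (h : w⁻¹ k.castSucc < w⁻¹ k.succ) :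
    TW (simpleT (r := n + 1) k * w) = TT R q (n + 1) k * TW w := by
  refine TW_left_aux hTW k _ w rfl ?_
  rw [len_left, len_up _ _ h, len_inv]

theorem T_one_add (k : Fin n) :
    (1 + TT R q (n + 1) k) * TT R q (n + 1) k = q • (1 + TT R q (n + 1) k) := by
  rw [add_mul, T_quad, one_mul, sub_one_smul', smul_add]
  abel

theorem T_one_add' (k : Fin n) :
    TT R q (n + 1) k * (1 + TT R q (n + 1) k) = q • (1 + TT R q (n + 1) k) := by
  rw [mul_add, T_quad, mul_one, sub_one_smul', smul_add]
  abel

theorem x_right (hTW : IsTW q (n + 1) TW) (k : Fin n) :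
    (∑ w, TW w) * TT R q (n + 1) k = q • ∑ w, TW w := by
  have hx : (∑ w, TW w) = (∑ w with w k.castSucc < w k.succ, TW w) * (1 + TT R q (n + 1) k) := by
    rw [← Finset.sum_filter_add_sum_filter_not _ (fun w => w k.castSucc < w k.succ), mul_add,
      mul_one]
    congr 1
    rw [Finset.sum_mul]
    symm
    refine Finset.sum_bij' (fun w _ => w * simpleT (r := n + 1) k)
      (fun w _ => w * simpleT (r := n + 1) k) ?_ ?_ ?_ ?_ ?_
    · intro w hw
      simp only [Finset.mem_filter, Finset.mem_univ, true_and, Equiv.Perm.mul_apply, simpleT_lo,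
        simpleT_hi] at hw ⊢
      exact hw.asymm
    · intro w hw
      simp only [Finset.mem_filter, Finset.mem_univ, true_and, Equiv.Perm.mul_apply, simpleT_lo,
        simpleT_hi] at hw ⊢
      exact lt_of_le_of_ne (not_lt.1 hw) (ne_vals w k).symm
    · intro w _
      rw [mul_assoc, simpleT_sq, mul_one]
    · intro w _
      rw [mul_assoc, simpleT_sq, mul_one]
    · intro w hw
      simp only [Finset.mem_filter, Finset.mem_univ, true_and] at hw
      exact (TW_right hTW w k hw).symm
  rw [hx, mul_assoc, T_one_add, mul_smul_comm]

theorem x_left (hTW : IsTW q (n + 1) TW) (k : Fin n) :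
    TT R q (n + 1) k * (∑ w, TW w) = q • ∑ w, TW w := by
  have hx : (∑ w, TW w) =
      (1 + TT R q (n + 1) k) * (∑ w with w⁻¹ k.castSucc < w⁻¹ k.succ, TW w) := by
    rw [← Finset.sum_filter_add_sum_filter_not _ (fun w => w⁻¹ k.castSucc < w⁻¹ k.succ), add_mul,
      one_mul]
    congr 1
    rw [Finset.mul_sum]
    symm
    refine Finset.sum_bij' (fun w _ => simpleT (r := n + 1) k * w)
      (fun w _ => simpleT (r := n + 1) k * w) ?_ ?_ ?_ ?_ ?_
    · intro w hw
      simp only [Finset.mem_filter, Finset.mem_univ, true_and, mul_inv_rev, simpleT_inv,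
        Equiv.Perm.mul_apply, simpleT_lo, simpleT_hi] at hw ⊢
      exact hw.asymm
    · intro w hw
      simp only [Finset.mem_filter, Finset.mem_univ, true_and, mul_inv_rev, simpleT_inv,
        Equiv.Perm.mul_apply, simpleT_lo, simpleT_hi] at hw ⊢
      exact lt_of_le_of_ne (not_lt.1 hw) (ne_vals w⁻¹ k).symm
    · intro w _
      rw [← mul_assoc, simpleT_sq, one_mul]
    · intro w _
      rw [← mul_assoc, simpleT_sq, one_mul]
    · intro w hw
      simp only [Finset.mem_filter, Finset.mem_univ, true_and] at hw
      exact (TW_left hTW w k hw).symm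
  rw [hx, ← mul_assoc, T_one_add', smul_mul_assoc]

/-- Sum over the permutations with `w k = last`. -/
theorem F_step (hTW : IsTW q (n + 1) TW) (k : Fin n) :
    (∑ w with w k.castSucc = Fin.last n, TW w) =
      (∑ w with w k.succ = Fin.last n, TW w) * TT R q (n + 1) k := by
  rw [Finset.sum_mul]
  symm
  refine Finset.sum_bij' (fun w _ => w * simpleT (r := n + 1) k)
    (fun w _ => w * simpleT (r := n + 1) k) ?_ ?_ ?_ ?_ ?_
  · intro w hw
    simpa only [Finset.mem_filter, Finset.mem_univ, true_and, Equiv.Perm.mul_apply, simpleT_lo,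
      simpleT_hi] using hw
  · intro w hw
    simpa only [Finset.mem_filter, Finset.mem_univ, true_and, Equiv.Perm.mul_apply, simpleT_lo,
      simpleT_hi] using hw
  · intro w _
    rw [mul_assoc, simpleT_sq, mul_one]
  · intro w _
    rw [mul_assoc, simpleT_sq, mul_one]
  · intro w hw
    simp only [Finset.mem_filter, Finset.mem_univ, true_and] at hw
    exact (TW_right hTW w k (lt_of_le_of_ne (hw ▸ Fin.le_last _) (ne_vals w k))).symm

theorem G_step (hTW : IsTW q (n + 1) TW) (k : Fin n) :
    (∑ w with w⁻¹ k.castSucc = Fin.last n, TW w) =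
      TT R q (n + 1) k * (∑ w with w⁻¹ k.succ = Fin.last n, TW w) := by
  rw [Finset.mul_sum]
  symm
  refine Finset.sum_bij' (fun w _ => simpleT (r := n + 1) k * w)
    (fun w _ => simpleT (r := n + 1) k * w) ?_ ?_ ?_ ?_ ?_
  · intro w hw
    simpa only [Finset.mem_filter, Finset.mem_univ, true_and, mul_inv_rev, simpleT_inv,
      Equiv.Perm.mul_apply, simpleT_lo, simpleT_hi] using hw
  · intro w hw
    simpa only [Finset.mem_filter, Finset.mem_univ, true_and, mul_inv_rev, simpleT_inv,
      Equiv.Perm.mul_apply, simpleT_lo, simpleT_hi] using hw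
  · intro w _
    rw [← mul_assoc, simpleT_sq, one_mul]
  · intro w _
    rw [← mul_assoc, simpleT_sq, one_mul]
  · intro w hw
    simp only [Finset.mem_filter, Finset.mem_univ, true_and] at hw
    exact (TW_left hTW w k (lt_of_le_of_ne (hw ▸ Fin.le_last _) (ne_vals w⁻¹ k))).symm

theorem sum_F : (∑ k, ∑ w with w k = Fin.last n, TW w) = ∑ w, TW w := by
  simp_rw [Finset.sum_filter]
  rw [Finset.sum_comm]
  refine Finset.sum_congr rfl fun w _ => ?_
  rw [Finset.sum_eq_single (w⁻¹ (Fin.last n))]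
  · simp
  · intro b _ hb
    rw [if_neg]
    rintro h
    apply hb
    rw [← h]
    simp
  · simp

theorem sum_G : (∑ k, ∑ w with w⁻¹ k = Fin.last n, TW w) = ∑ w, TW w := by
  simp_rw [Finset.sum_filter]
  rw [Finset.sum_comm]
  refine Finset.sum_congr rfl fun w _ => ?_
  rw [Finset.sum_eq_single (w (Fin.last n))]
  · simp
  · intro b _ hb
    rw [if_neg]
    rintro h
    apply hb
    rw [← h]
    simp
  · simp

theorem TW_comm_aux (hTW : IsTW q (n + 1) TW) (m : ℕ) :
    ∀ w : Equiv.Perm (Fin (n + 1)), len w = m → w (Fin.last n) = Fin.last n →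
      TW w * CC R q (n + 1) (Fin.last n) = CC R q (n + 1) (Fin.last n) * TW w := by
  induction m using Nat.strong_induction_on with
  | _ m ih =>
    intro w hm hl
    by_cases hw : w = 1
    · rw [hw, hTW.1, one_mul, mul_one]
    · obtain ⟨v, j, hd, e, hlen, hT⟩ := exists_factor hTW w hw
      have hj : Fin.last n ≠ j.succ := by
        intro h
        rw [← h, hl] at hd
        exact absurd hd (Fin.le_last _).not_gt
      have hj' : Fin.last n ≠ j.castSucc := (Fin.castSucc_lt_last j).ne'
      have hs : simpleT (r := n + 1) j (Fin.last n) = Fin.last n :=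
        Equiv.swap_apply_of_ne_of_ne hj' hj
      have hv : v (Fin.last n) = Fin.last n := by
        rw [e, Equiv.Perm.mul_apply, hs] at hl
        exact hl
      rw [hT, mul_assoc, T_comm j _ hj' hj, ← mul_assoc, ih (len v) (by omega) v rfl hv, mul_assoc]

/-- The coefficients of `T_k ⋯ T_{r-1} c_r x`. -/
noncomputable def eCoef (R : Type) [CommRing R] (q : R) (k j : ℕ) : R :=
  if j < k then 0 else if j = k then 1 else (q - 1) * q ^ (j - k - 1)

theorem sum_eCoef (j m : ℕ) (hj : j < m) : ∑ k ∈ Finset.range m, eCoef R q k j = q ^ j := by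
  obtain ⟨d, rfl⟩ : ∃ d, m = j + 1 + d := ⟨m - (j + 1), by omega⟩
  rw [Finset.sum_range_add, Finset.sum_eq_zero (s := Finset.range d), add_zero]
  · clear hj
    rw [Finset.sum_range_succ]
    have h0 : eCoef R q j j = 1 := by simp [eCoef]
    have h1 : ∑ k ∈ Finset.range j, eCoef R q k j = ∑ k ∈ Finset.range j, (q - 1) * q ^ (j - 1 - k) := by
      refine Finset.sum_congr rfl fun k hk => ?_
      have := Finset.mem_range.1 hk
      rw [eCoef, if_neg (by omega), if_neg (by omega), show j - k - 1 = j - 1 - k by omega]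
    rw [h0, h1, Finset.sum_range_reflect (fun k => (q - 1) * q ^ k) j, ← Finset.mul_sum,
      mul_geom_sum]
    ring
  · intro k _
    rw [eCoef, if_pos (by omega)]

theorem E_step (k : Fin n) (X : HC R q (n + 1))
    (hX : TT R q (n + 1) k * X = q • X) :
    TT R q (n + 1) k * ((∑ j : Fin (n + 1), eCoef R q (k.val + 1) j.val • CC R q (n + 1) j) * X) =
    (∑ j : Fin (n + 1), eCoef R q k.val j.val • CC R q (n + 1) j) * X := by
  have key : ∀ j : Fin (n + 1), TT R q (n + 1) k * CC R q (n + 1) j * X =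
      if j = k.succ then (CC R q (n + 1) k.castSucc + (q - 1) • CC R q (n + 1) k.succ) * X
      else if j = k.castSucc then q • CC R q (n + 1) k.succ * X
      else q • CC R q (n + 1) j * X := by
    intro j
    split_ifs with h1 h2
    · subst h1
      rw [T_hi, sub_mul, mul_assoc, hX, mul_smul_comm]
      simp only [add_mul, sub_mul, smul_mul_assoc, sub_one_smul', smul_sub]
      abel
    · subst h2
      rw [T_lo, mul_assoc, hX, mul_smul_comm, smul_mul_assoc]
    · rw [T_comm k j h2 h1, mul_assoc, hX, mul_smul_comm, smul_mul_assoc]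
  rw [← mul_assoc, Finset.mul_sum, Finset.sum_mul, Finset.sum_mul]
  have hne : k.castSucc ≠ k.succ := Fin.castSucc_lt_succ.ne
  have split : ∀ f : Fin (n + 1) → HC R q (n + 1), ∑ j, f j =
      f k.castSucc + (f k.succ + ∑ j ∈ (Finset.univ.erase k.castSucc).erase k.succ, f j) := by
    intro f
    rw [Finset.add_sum_erase _ f (by simp [hne.symm]), Finset.add_sum_erase _ f (by simp)]
  rw [split, split]
  have r1 : ∑ j ∈ (Finset.univ.erase k.castSucc).erase k.succ,
      TT R q (n + 1) k * eCoef R q (k.val + 1) j.val • CC R q (n + 1) j * X =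
      ∑ j ∈ (Finset.univ.erase k.castSucc).erase k.succ,
        eCoef R q k.val j.val • CC R q (n + 1) j * X := by
    refine Finset.sum_congr rfl fun j hj => ?_
    simp only [Finset.mem_erase, Finset.mem_univ, and_true] at hj
    rw [mul_smul_comm, smul_mul_assoc, key, if_neg hj.1, if_neg hj.2, smul_mul_assoc, smul_smul,
      smul_mul_assoc]
    congr 1
    have a1 : j.val ≠ k.val + 1 := fun h => hj.1 (Fin.ext h)
    have a2 : j.val ≠ k.val := fun h => hj.2 (Fin.ext h)
    unfold eCoef
    by_cases hlt : j.val < k.val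
    · rw [if_pos (by omega), if_pos hlt, zero_mul]
    · rw [if_neg (by omega), if_neg a1, if_neg hlt, if_neg a2,
        show j.val - k.val - 1 = j.val - (k.val + 1) - 1 + 1 by omega, pow_succ, mul_assoc]
  rw [r1, ← add_assoc, ← add_assoc]
  congr 1
  rw [mul_smul_comm, smul_mul_assoc, mul_smul_comm, smul_mul_assoc, key, key, if_pos rfl]
  simp [eCoef, add_mul]

theorem main_succ (hTW : IsTW q (n + 1) TW) :
    (∑ w, TW w) * cqr R q (n + 1) = cqr' R q (n + 1) * ∑ w, TW w := by
  -- the parabolic part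
  have hx' : ∃ X' : HC R q (n + 1), X' = ∑ w with w (Fin.last n) = Fin.last n, TW w := ⟨_, rfl⟩
  obtain ⟨X', hX'⟩ := hx'
  have hcomm : X' * CC R q (n + 1) (Fin.last n) = CC R q (n + 1) (Fin.last n) * X' := by
    rw [hX', Finset.sum_mul, Finset.mul_sum]
    refine Finset.sum_congr rfl fun w hw => ?_
    simp only [Finset.mem_filter, Finset.mem_univ, true_and] at hw
    exact TW_comm_aux hTW _ w rfl hw
  have hE : ∀ k : Fin (n + 1), ∃ E : HC R q (n + 1),
      (∑ w with w⁻¹ k = Fin.last n, TW w) = E * X' ∧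
      E * (CC R q (n + 1) (Fin.last n) * ∑ w, TW w) =
        (∑ j : Fin (n + 1), eCoef R q k.val j.val • CC R q (n + 1) j) * ∑ w, TW w := by
    intro k
    induction k using Fin.reverseInduction with
    | last =>
      refine ⟨1, ?_, ?_⟩
      · rw [one_mul, hX']
        refine Finset.sum_congr ?_ fun _ _ => rfl
        ext w
        simp only [Finset.mem_filter, Finset.mem_univ, true_and]
        rw [Equiv.Perm.inv_eq_iff_eq]
        exact eq_comm
      · rw [one_mul]
        congr 1
        rw [Finset.sum_eq_single (Fin.last n)]
        · simp [eCoef]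
        · intro b _ hb
          rw [eCoef, if_pos, zero_smul]
          exact Fin.lt_last_iff_ne_last.2 hb
        · simp
    | cast k ih =>
      obtain ⟨E, h1, h2⟩ := ih
      refine ⟨TT R q (n + 1) k * E, ?_, ?_⟩
      · rw [G_step hTW, h1, mul_assoc]
      · rw [mul_assoc, h2]
        exact E_step k _ (x_left hTW k)
  choose E hE1 hE2 using hE
  have hx : (∑ w, TW w) = (∑ k, E k) * X' := by
    rw [← sum_G, Finset.sum_mul]
    exact Finset.sum_congr rfl fun k _ => hE1 k
  have hA : ∀ k : Fin (n + 1), q ^ (n - k.val) • ((∑ w, TW w) * CC R q (n + 1) k) =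
      (∑ l, E l) * (CC R q (n + 1) (Fin.last n) * ∑ w with w k = Fin.last n, TW w) := by
    intro k
    induction k using Fin.reverseInduction with
    | last =>
      rw [← hX', ← hcomm, ← mul_assoc, ← hx]
      simp
    | cast k ih =>
      rw [F_step hTW, ← mul_assoc, ← mul_assoc, mul_assoc (∑ l, E l), ← ih, smul_mul_assoc,
        mul_assoc, ← T_lo, ← mul_assoc, x_right hTW, smul_mul_assoc, smul_smul, ← pow_succ]
      congr 2
      simp only [Fin.val_castSucc, Fin.val_succ]
      omega
  have hL : (∑ w, TW w) * cqr R q (n + 1) =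
      (∑ l, E l) * (CC R q (n + 1) (Fin.last n) * ∑ w, TW w) := by
    conv_rhs => rw [← sum_F]
    rw [cqr, Finset.mul_sum, Finset.mul_sum, Finset.mul_sum]
    refine Finset.sum_congr rfl fun k _ => ?_
    rw [← hA, mul_smul_comm]
    rfl
  rw [hL, Finset.sum_mul]
  simp_rw [hE2]
  rw [← Finset.sum_mul, Finset.sum_comm, cqr']
  congr 1
  refine Finset.sum_congr rfl fun j _ => ?_
  rw [← Finset.sum_smul]
  congr 1
  rw [← sum_eCoef j.val (n + 1) j.isLt]
  exact Fin.sum_univ_eq_sum_range (fun k => eCoef R q k j.val) (n + 1)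

end helpers

end HCPaper

open HCPaper in
/-- `x_{(r)} c_{q,r} = c'_{q,r} x_{(r)}` in the Hecke-Clifford superalgebra. -/
theorem stmt6 (R : Type) [CommRing R] (h2 : ringChar R ≠ 2) (q : R) (r : ℕ)
    (TW : Equiv.Perm (Fin r) → HC R q r) (hTW : IsTW q r TW) :
    (∑ w : Equiv.Perm (Fin r), TW w) * cqr R q r
      = cqr' R q r * (∑ w : Equiv.Perm (Fin r), TW w) := by
  cases r with
  | zero => simp [cqr, cqr']
  | succ n => exact main_succ hTW
end

section
/- Let y_{(r)} = Σ_{w ∈ S_r} (-q^{-1})^{ℓ(w)} T_w in H^c_{r,R} with q invertible, and let c_{q,r} = q^{r-1} c_1 + ··· + c_r and c'_{q,r} = c_1 + q c_2 + ··· + q^{r-1} c_r. Then y_{(r)} c'_{q,r} = c_{q,r} y_{(r)}. -/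
namespace HCPaper

structure HRel {R A : Type} [CommRing R] [Ring A] [Algebra R A] (p q : R) (N : ℕ)
    (T c : ℕ → A) : Prop where
  pq : p * q = 1
  quad : ∀ i, i + 1 < N → T i * T i = (q - 1) • T i + q • (1 : A)
  comm : ∀ i j, i + 1 < j → T i * T j = T j * T i
  braid : ∀ i, T i * T (i + 1) * T i = T (i + 1) * T i * T (i + 1)
  commTC : ∀ i j, j ≠ i → j ≠ i + 1 → T i * c j = c j * T i
  lo : ∀ i, T i * c i = c (i + 1) * T i
  hi : ∀ i, i + 1 < N → T i * c (i + 1) = c i * T i - (q - 1) • (c i - c (i + 1))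

section Abs

variable {R A : Type} [CommRing R] [Ring A] [Algebra R A]

def Bs (p : R) (T : ℕ → A) : ℕ → A
  | 0 => 1
  | n + 1 => 1 - p • (T n * Bs p T n)

def Bb (p : R) (T : ℕ → A) : ℕ → A
  | 0 => 1
  | n + 1 => 1 - p • (Bb p T n * T n)

def Ys (p : R) (T : ℕ → A) : ℕ → A
  | 0 => 1
  | n + 1 => Ys p T n * Bs p T n

def Cs (q : R) (c : ℕ → A) : ℕ → A
  | 0 => 0
  | n + 1 => q • Cs q c n + c n

def Ss (p : R) : ℕ → R
  | 0 => 1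
  | n + 1 => 1 + p * Ss p n

theorem Bs_comm (p : R) (T : ℕ → A) (n : ℕ) (x : A) (h : ∀ i < n, T i * x = x * T i) :
    Bs p T n * x = x * Bs p T n := by
  induction n with
  | zero => simp [Bs]
  | succ n ih =>
    have h1 := ih fun i hi => h i (by omega)
    have h2 := h n (by omega)
    simp only [Bs, sub_mul, mul_sub, one_mul, mul_one, smul_mul_assoc, mul_smul_comm]
    rw [mul_assoc, h1, ← mul_assoc, h2, mul_assoc]

theorem Bb_comm (p : R) (T : ℕ → A) (n : ℕ) (x : A) (h : ∀ i < n, T i * x = x * T i) :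
    Bb p T n * x = x * Bb p T n := by
  induction n with
  | zero => simp [Bb]
  | succ n ih =>
    have h1 := ih fun i hi => h i (by omega)
    have h2 := h n (by omega)
    simp only [Bb, sub_mul, mul_sub, one_mul, mul_one, smul_mul_assoc, mul_smul_comm]
    rw [mul_assoc, h2, ← mul_assoc, h1, mul_assoc]

theorem Ys_comm (p : R) (T : ℕ → A) (n : ℕ) (x : A) (h : ∀ i, i + 1 < n → T i * x = x * T i) :
    Ys p T n * x = x * Ys p T n := by
  induction n with
  | zero => simp [Ys]
  | succ n ih =>
    have h1 := ih fun i hi => h i (by omega)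
    simp only [Ys]
    rw [mul_assoc, Bs_comm p T n x (fun i hi => h i (by omega)), ← mul_assoc, h1, mul_assoc]

variable {p q : R} {N : ℕ} {T c : ℕ → A}

theorem HRel.qp (H : HRel p q N T c) (i : ℕ) (hi : i + 1 < N) (x : A) :
    T i * (x - p • (T i * x)) = -(x - p • (T i * x)) := by
  have h : T i * (T i * x) = (q - 1) • (T i * x) + q • x := by
    rw [← mul_assoc, H.quad i hi, add_mul, smul_mul_assoc, smul_mul_assoc, one_mul]
  rw [mul_sub, mul_smul_comm, h]
  linear_combination (norm := module) (-H.pq) • (T i * x) - (H.pq) • x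

theorem HRel.TBB (H : HRel p q N T c) (n : ℕ) (hn : n + 1 < N) :
    T n * (Bs p T n * Bs p T (n + 1)) = -(Bs p T n * Bs p T (n + 1)) := by
  induction n with
  | zero =>
    have := H.qp 0 hn 1
    simpa [Bs] using this
  | succ n ih =>
    have ih := ih (by omega)
    have hbt : Bs p T n * T (n + 1) = T (n + 1) * Bs p T n :=
      Bs_comm p T n _ fun i hi => H.comm i (n + 1) (by omega)
    have hbr := H.braid n
    have e3 : Bs p T (n + 2) = 1 - p • (T (n + 1) * Bs p T (n + 1)) := rfl
    have e2 : Bs p T (n + 1) = 1 - p • (T n * Bs p T n) := rfl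
    have key : Bs p T (n + 1) * Bs p T (n + 2) =
        (Bs p T (n + 1) - p • (T (n + 1) * Bs p T (n + 1)))
        + (p * p) • (T n * (T (n + 1) * (Bs p T n * Bs p T (n + 1)))) := by
      have : T n * (T (n + 1) * (Bs p T n * Bs p T (n + 1)))
          = T n * Bs p T n * (T (n + 1) * Bs p T (n + 1)) := by
        rw [← mul_assoc (T (n + 1)), ← hbt]
        simp only [mul_assoc]
      rw [this, e3]
      generalize T (n + 1) * Bs p T (n + 1) = z
      rw [mul_sub, mul_one, mul_smul_comm]
      rw [show Bs p T (n + 1) * z = (1 - p • (T n * Bs p T n)) * z from by rw [e2]]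
      rw [sub_mul, one_mul, smul_mul_assoc]
      module
    rw [key, mul_add, H.qp (n + 1) hn, mul_smul_comm]
    have : T (n + 1) * (T n * (T (n + 1) * (Bs p T n * Bs p T (n + 1)))) =
        - (T n * (T (n + 1) * (Bs p T n * Bs p T (n + 1)))) := by
      generalize hZ : Bs p T n * Bs p T (n + 1) = Z at ih ⊢
      have : T (n + 1) * (T n * (T (n + 1) * Z)) = T n * (T (n + 1) * (T n * Z)) := by
        simp only [← mul_assoc]
        rw [hbr]
      rw [this, ih, mul_neg, mul_neg]
    rw [this]
    module

theorem HRel.TY (H : HRel p q N T c) (n : ℕ) (hn : n ≤ N) (i : ℕ) (hi : i + 1 < n) :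
    T i * Ys p T n = - Ys p T n := by
  induction n with
  | zero => omega
  | succ n ih =>
    by_cases h : i + 1 < n
    · rw [Ys, ← mul_assoc, ih (by omega) h, neg_mul]
    · obtain rfl : n = i + 1 := by omega
      have hc : Ys p T i * T i = T i * Ys p T i :=
        Ys_comm p T i _ fun j hj => H.comm j i (by omega)
      rw [Ys, Ys, mul_assoc, ← mul_assoc, ← hc, mul_assoc, H.TBB i (by omega), mul_neg]

theorem HRel.YB (H : HRel p q N T c) (n : ℕ) :
    Ys p T n * Bs p T n = Bb p T n * Ys p T n := by
  induction n with
  | zero => simp [Bs, Bb, Ys]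
  | succ n ih =>
    have hc : Ys p T n * T n = T n * Ys p T n :=
      Ys_comm p T n _ fun j hj => H.comm j n (by omega)
    simp only [Bs, Bb, mul_sub, sub_mul, one_mul, mul_one, mul_smul_comm, smul_mul_assoc]
    congr 2
    rw [Ys, mul_assoc (Bb p T n), ← mul_assoc (T n), ← hc, ih]
    simp only [← mul_assoc]

theorem BbZ (n : ℕ) (Z : A) (hZ : ∀ i < n, T i * Z = -Z) : Bb p T n * Z = Ss p n • Z := by
  induction n with
  | zero => simp [Bb, Ss]
  | succ n ih =>
    simp only [Bb, Ss, sub_mul, one_mul, smul_mul_assoc, mul_assoc]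
    rw [hZ n (by omega), mul_neg, ih fun i hi => hZ i (by omega)]
    module

theorem HRel.Sq (H : HRel p q N T c) (n : ℕ) : q ^ n * (q - 1) * Ss p n = q ^ (n + 1) - 1 := by
  induction n with
  | zero => simp [Ss]
  | succ n ih =>
    rw [Ss]
    linear_combination ih + (q ^ n * (q - 1) * Ss p n) * H.pq

theorem HRel.D (H : HRel p q N T c) (n : ℕ) (hn : n < N) (Z : A) (hZ : ∀ i < n, T i * Z = -Z) :
    q ^ n • (Bb p T n * (c n * Z)) = Cs q c (n + 1) * Z := by
  induction n with
  | zero => simp [Bb, Cs]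
  | succ n ih =>
    have ih := ih (by omega) fun i hi => hZ i (by omega)
    have h1 : T n * (c (n + 1) * Z) = (-q) • (c n * Z) + (q - 1) • (c (n + 1) * Z) := by
      rw [← mul_assoc, H.hi n hn, sub_mul, mul_assoc, hZ n (by omega), smul_mul_assoc, sub_mul,
        mul_neg]
      module
    have hcc : Bb p T n * (c (n + 1) * Z) = Ss p n • (c (n + 1) * Z) := by
      rw [← mul_assoc, Bb_comm p T n _ fun i hi => H.commTC i (n + 1) (by omega) (by omega),
        mul_assoc, BbZ n Z fun i hi => hZ i (by omega), mul_smul_comm]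
    rw [Bb, Cs, add_mul, smul_mul_assoc, ← ih, sub_mul, one_mul, smul_mul_assoc, mul_assoc, h1,
      mul_add, mul_smul_comm, mul_smul_comm, hcc]
    have hs := H.Sq n
    generalize Bb p T n * (c n * Z) = X
    generalize c (n + 1) * Z = W
    linear_combination (norm := module) (q ^ (n + 1) * H.pq) • X
      - (q ^ n * (q - 1) * Ss p n * H.pq + hs) • W

theorem Cs_comm (x : A) (n : ℕ) (h : ∀ i < n, x * c i = c i * x) :
    x * Cs q c n = Cs q c n * x := by
  induction n with
  | zero => simp [Cs]
  | succ n ih =>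
    rw [Cs, mul_add, add_mul, mul_smul_comm, smul_mul_assoc, ih fun i hi => h i (by omega),
      h n (by omega)]

theorem HRel.main (H : HRel p q N T c) (n : ℕ) (hn : n < N) :
    Bb p T n * ((Cs q c n + q ^ n • c n) * Ys p T n) =
      Cs q c (n + 1) * (Bb p T n * Ys p T n) := by
  induction n with
  | zero => simp [Bb, Cs]
  | succ n ih =>
    have ih := ih (by omega)
    have hc : Ys p T n * T n = T n * Ys p T n :=
      Ys_comm p T n _ fun j hj => H.comm j n (by omega)
    have hTY : T n * Ys p T (n + 1) = Ys p T n * (T n * Bs p T n) := by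
      rw [Ys, ← mul_assoc, ← hc, mul_assoc]
    have hZ : ∀ i < n, T i * Ys p T (n + 1) = - Ys p T (n + 1) :=
      fun i hi => H.TY (n + 1) (by omega) i (by omega)
    have ih2 : Bb p T n * ((Cs q c n + q ^ n • c n) * (T n * Ys p T (n + 1))) =
      Cs q c (n + 1) * (Bb p T n * (T n * Ys p T (n + 1))) := by
      rw [hTY]
      have := congrArg (· * (T n * Bs p T n)) ih
      simpa only [mul_assoc] using this
    have hD := H.D n (by omega) _ hZ
    have hS := BbZ (p := p) n _ hZ
    have hBc : Bb p T n * c (n + 1) = c (n + 1) * Bb p T n :=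
      Bb_comm p T n _ fun i hi => H.commTC i (n + 1) (by omega) (by omega)
    have hTC : T n * Cs q c n = Cs q c n * T n :=
      Cs_comm _ _ fun i hi => H.commTC n i (by omega) (by omega)
    have hs := H.Sq n
    have hlo := H.lo n
    have hhi := H.hi n hn
    generalize Ys p T (n + 1) = Y at *
    have hX : T n * ((Cs q c (n + 1) + q ^ (n + 1) • c (n + 1)) * Y) =
        q • ((Cs q c n + q ^ n • c n) * (T n * Y)) + c (n + 1) * (T n * Y)
        - (q ^ (n + 1) * (q - 1)) • (c n * Y) + (q ^ (n + 1) * (q - 1)) • (c (n + 1) * Y) := by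
      rw [← mul_assoc, mul_add, mul_smul_comm, hhi, Cs, mul_add, mul_smul_comm, hTC, hlo]
      simp only [add_mul, sub_mul, smul_mul_assoc, mul_assoc, smul_sub, smul_add, mul_smul_comm]
      module
    have hcS : Bb p T n * (c (n + 1) * Y) = Ss p n • (c (n + 1) * Y) := by
      rw [← mul_assoc, hBc, mul_assoc, hS, mul_smul_comm]
    have hcT : Bb p T n * (c (n + 1) * (T n * Y)) = c (n + 1) * (Bb p T n * (T n * Y)) := by
      rw [← mul_assoc, hBc, mul_assoc]
    rw [Bb, sub_mul, one_mul, smul_mul_assoc, mul_assoc, hX, mul_add, mul_sub, mul_add,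
      mul_smul_comm, mul_smul_comm, mul_smul_comm, ih2, hcS, hcT]
    rw [show Cs q c (n + 1 + 1) = q • Cs q c (n + 1) + c (n + 1) from rfl]
    simp only [add_mul, sub_mul, mul_sub, one_mul, smul_mul_assoc, mul_assoc, mul_smul_comm]
    rw [← hD]
    generalize Bb p T n * (c n * Y) = X1
    generalize Bb p T n * (T n * Y) = X2
    generalize c (n + 1) * Y = X3
    linear_combination (norm := module) (q ^ n * (q - 1) * H.pq) • X1
      - (q ^ n * (q - 1) * Ss p n * H.pq + hs) • X3

theorem HRel.final (H : HRel p q N T c) (n : ℕ) (hn : n ≤ N) :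
    Ys p T n * (∑ j ∈ Finset.range n, q ^ j • c j) = Cs q c n * Ys p T n := by
  induction n with
  | zero => simp [Cs]
  | succ n ih =>
    have ih := ih (by omega)
    have hc : Ys p T n * c n = c n * Ys p T n :=
      Ys_comm p T n _ fun j hj => H.commTC j n (by omega) (by omega)
    rw [Ys, H.YB, ← H.main n (by omega), Finset.sum_range_succ, mul_assoc, mul_add, ih,
      mul_smul_comm, hc, add_mul, smul_mul_assoc]

theorem Cs_sum (n : ℕ) : Cs q c n = ∑ j ∈ Finset.range n, q ^ (n - 1 - j) • c j := by
  induction n with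
  | zero => simp [Cs]
  | succ n ih =>
    rw [Cs, ih, Finset.sum_range_succ, Finset.smul_sum]
    congr 1
    · refine Finset.sum_congr rfl fun j hj => ?_
      rw [Finset.mem_range] at hj
      rw [smul_smul, ← pow_succ']
      congr 2
      omega
    · simp

theorem sumE (E : ℕ → A) (n : ℕ) (h : ∀ k < n, E k = (-p) • (E (k + 1) * T k)) :
    ∑ k ∈ Finset.range (n + 1), E k = E n * Bs p T n := by
  induction n with
  | zero => simp [Bs]
  | succ n ih =>
    rw [Finset.sum_range_succ, ih fun k hk => h k (by omega), h n (by omega), Bs, mul_sub,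
      mul_one, mul_smul_comm, smul_mul_assoc, mul_assoc]
    module

end Abs

section Comb

variable {r : ℕ}

theorem simpleT_lt_s7 (k : Fin (r - 1)) (a b : Fin r) (h1 : (a, b) ≠ (loIdx k, hiIdx k))
    (hab : a < b) : simpleT k a < simpleT k b := by
  simp only [ne_eq, Prod.mk.injEq, simpleT, Equiv.swap_apply_def, loIdx, hiIdx, Fin.ext_iff,
    Fin.lt_def] at *
  split_ifs <;> simp <;> omega

theorem simpleT_lo_s7 (k : Fin (r - 1)) : simpleT k (loIdx k) = hiIdx k :=
  Equiv.swap_apply_left _ _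

theorem simpleT_hi_s7 (k : Fin (r - 1)) : simpleT k (hiIdx k) = loIdx k :=
  Equiv.swap_apply_right _ _

theorem simpleT_simpleT (k : Fin (r - 1)) (a : Fin r) : simpleT k (simpleT k a) = a :=
  Equiv.swap_apply_self _ _ _

theorem len_mul (w : Equiv.Perm (Fin r)) (k : Fin (r - 1)) (h : w (loIdx k) < w (hiIdx k)) :
    len (w * simpleT k) = len w + 1 := by
  classical
  have hlt : loIdx k < hiIdx k := by simp [loIdx, hiIdx, Fin.lt_def]
  have key : (Finset.univ.filter fun x : Fin r × Fin r =>
      x.1 < x.2 ∧ (w * simpleT k) x.2 < (w * simpleT k) x.1) =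
      insert (loIdx k, hiIdx k) ((Finset.univ.filter fun x : Fin r × Fin r =>
        x.1 < x.2 ∧ w x.2 < w x.1).map
          ((simpleT k).prodCongr (simpleT k)).toEmbedding) := by
    ext ⟨a, b⟩
    rw [Finset.mem_insert, Finset.mem_filter, Finset.mem_map]
    simp only [Finset.mem_filter, Finset.mem_univ, true_and, Finset.mem_insert, Finset.mem_map,
      Equiv.Perm.mul_apply, Equiv.coe_toEmbedding, Equiv.prodCongr_apply, Prod.exists,
      Prod.map_apply]
    constructor
    · rintro ⟨h1, h2⟩
      by_cases he : (a, b) = (loIdx k, hiIdx k)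
      · exact Or.inl he
      · refine Or.inr ⟨simpleT k a, simpleT k b, ⟨simpleT_lt_s7 k a b he h1, h2⟩, ?_⟩
        rw [simpleT_simpleT, simpleT_simpleT]
    · rintro (he | ⟨a', b', ⟨h1, h2⟩, he⟩)
      · rw [Prod.mk.injEq] at he
        rw [he.1, he.2, simpleT_lo_s7, simpleT_hi_s7]
        exact ⟨hlt, h⟩
      · rw [Prod.mk.injEq] at he
        rw [← he.1, ← he.2, simpleT_simpleT, simpleT_simpleT]
        refine ⟨simpleT_lt_s7 k a' b' ?_ h1, h2⟩
        rintro he2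
        rw [Prod.mk.injEq] at he2
        rw [he2.1, he2.2] at h2
        exact lt_asymm h h2
  unfold len
  rw [key, Finset.card_insert_of_notMem, Finset.card_map]
  simp only [Finset.mem_filter, Finset.mem_univ, true_and, Finset.mem_map,
      Equiv.coe_toEmbedding, Equiv.prodCongr_apply, Prod.exists, Prod.map_apply, Prod.mk.injEq]
  rintro ⟨a, b, ⟨h1, h2⟩, h3, h4⟩
  have ha : a = hiIdx k := by rw [← simpleT_simpleT k a, h3, simpleT_lo_s7]
  have hb : b = loIdx k := by rw [← simpleT_simpleT k b, h4, simpleT_hi_s7]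
  rw [ha, hb] at h1
  exact lt_asymm h1 hlt

theorem len_one : len (1 : Equiv.Perm (Fin r)) = 0 := by
  unfold len
  rw [Finset.card_eq_zero, Finset.filter_eq_empty_iff]
  rintro x - ⟨h1, h2⟩
  exact lt_asymm h1 h2

noncomputable def Tn (R : Type) [CommRing R] (q : R) (r : ℕ) (i : ℕ) : HC R q r :=
  if h : i < r - 1 then TT R q r ⟨i, h⟩ else 0

noncomputable def Cn (R : Type) [CommRing R] (q : R) (r : ℕ) (i : ℕ) : HC R q r :=
  if h : i < r then CC R q r ⟨i, h⟩ else 0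

variable {R : Type} [CommRing R] {q : R}

theorem hrel (p : R) (hpq : p * q = 1) : HRel p q r (Tn R q r) (Cn R q r) where
  pq := hpq
  quad i hi := by
    have h := RingQuot.mkAlgHom_rel R (HCRel.quad (R := R) (q := q) (r := r) ⟨i, by omega⟩)
    simp only [map_mul, map_sub, map_add, map_one, map_zero, AlgHom.commutes] at h
    rw [Tn, dif_pos (by omega)]
    change (TT R q r _ - algebraMap R _ q) * (TT R q r _ + 1) = 0 at h
    rw [sub_mul, mul_add, mul_one, ← Algebra.smul_def, smul_add] at h
    rw [← sub_eq_zero, ← h]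
    module
  comm i j hij := by
    unfold Tn
    split_ifs
    · have h := RingQuot.mkAlgHom_rel R (HCRel.commTT (R := R) (q := q) (r := r) ⟨i, by omega⟩
        ⟨j, by omega⟩ hij)
      simp only [map_mul] at h; exact h
    all_goals simp
  braid i := by
    unfold Tn
    split_ifs
    · have h := RingQuot.mkAlgHom_rel R (HCRel.braid (R := R) (q := q) (r := r) ⟨i, by omega⟩
        ⟨i + 1, by omega⟩ rfl)
      simp only [map_mul] at h; exact h
    all_goals simp
  commTC i j h1 h2 := by
    unfold Tn Cn
    split_ifs
    · have h := RingQuot.mkAlgHom_rel R (HCRel.commTC (R := R) (q := q) (r := r) ⟨i, by omega⟩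
        ⟨j, by omega⟩ h1 h2)
      simp only [map_mul] at h; exact h
    all_goals simp
  lo i := by
    by_cases hi : i < r - 1
    · rw [Tn, Cn, Cn, dif_pos hi, dif_pos (by omega), dif_pos (by omega)]
      have h := RingQuot.mkAlgHom_rel R (HCRel.TClo (R := R) (q := q) (r := r) ⟨i, by omega⟩)
      simp only [map_mul] at h; exact h
    · rw [Tn, dif_neg hi, zero_mul, mul_zero]
  hi i hi := by
    rw [Tn, Cn, Cn, dif_pos (by omega), dif_pos (by omega), dif_pos (by omega)]
    have h := RingQuot.mkAlgHom_rel R (HCRel.TChi (R := R) (q := q) (r := r) ⟨i, by omega⟩)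
    rw [← Algebra.smul_def] at h
    simp only [map_mul, map_sub, map_smul] at h; exact h

theorem Ysum (p : R) (TW : Equiv.Perm (Fin r) → HC R q r) (hTW : IsTW q r TW) (n : ℕ)
    (hn : n ≤ r) :
    ∑ w : Equiv.Perm (Fin r) with ∀ j : Fin r, n ≤ j.val → w j = j, (-p) ^ len w • TW w
      = Ys p (Tn R q r) n := by
  classical
  induction n with
  | zero =>
    have : (Finset.univ.filter fun w : Equiv.Perm (Fin r) => ∀ j : Fin r, 0 ≤ j.val → w j = j)
        = {1} := by
      ext w
      simp [Equiv.ext_iff]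
    rw [this, Finset.sum_singleton, len_one, hTW.1, Ys, pow_zero, one_smul]
  | succ n ih =>
    have ih := ih (by omega)
    let m : Fin r := ⟨n, by omega⟩
    let P : Finset (Equiv.Perm (Fin r)) :=
      Finset.univ.filter fun w => ∀ j : Fin r, n + 1 ≤ j.val → w j = j
    have hP : ∀ w, w ∈ P ↔ ∀ j : Fin r, n + 1 ≤ j.val → w j = j := fun w => by simp [P]
    let E : ℕ → HC R q r := fun k => ∑ w ∈ P with (w.symm m).val = k, (-p) ^ len w • TW w
    have hmaps : ∀ w ∈ P, (w.symm m).val ∈ Finset.range (n + 1) := by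
      intro w hw
      rw [hP] at hw
      rw [Finset.mem_range]
      by_contra hcon
      have h1 := hw (w.symm m) (by omega)
      rw [Equiv.apply_symm_apply] at h1
      rw [← h1] at hcon
      simp [m] at hcon
    change ∑ w ∈ P, (-p) ^ len w • TW w = _
    rw [← Finset.sum_fiberwise_of_maps_to hmaps]
    change ∑ k ∈ Finset.range (n + 1), E k = _
    rw [sumE (p := p) (T := Tn R q r), Ys, ← ih]
    · congr 1
      refine Finset.sum_congr ?_ fun _ _ => rfl
      ext w
      simp only [Finset.mem_filter, hP, Finset.mem_univ, true_and]
      constructor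
      · rintro ⟨h1, h2⟩ j hj
        by_cases hjn : j.val = n
        · have e1 : j = m := Fin.ext hjn
          have e2 : w.symm m = m := Fin.ext h2
          rw [e1]
          nth_rewrite 1 [← e2]
          exact Equiv.apply_symm_apply _ _
        · exact h1 j (by omega)
      · intro h
        refine ⟨fun j hj => h j (by omega), ?_⟩
        have := h m le_rfl
        rw [show w.symm m = m from (Equiv.symm_apply_eq _).2 this.symm]
    · intro k hk
      have hkr : k < r - 1 := by omega
      let s : Fin (r - 1) := ⟨k, hkr⟩
      have hss : simpleT s * simpleT s = 1 := Equiv.swap_mul_self _ _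
      have hsinv : (simpleT s).symm = simpleT s := Equiv.symm_swap _ _
      have hsP : ∀ w ∈ P, w * simpleT s ∈ P := by
        intro w hw
        rw [hP] at hw ⊢
        intro j hj
        have : simpleT s j = j := by
          apply Equiv.swap_apply_of_ne_of_ne
          · intro h; rw [h] at hj; simp [loIdx, s] at hj; omega
          · intro h; rw [h] at hj; simp [hiIdx, s] at hj; omega
        rw [Equiv.Perm.mul_apply, this, hw j hj]
      have hsymm : ∀ w : Equiv.Perm (Fin r), (w * simpleT s).symm m = simpleT s (w.symm m) := by
        intro w
        rw [Equiv.symm_apply_eq, Equiv.Perm.mul_apply, simpleT_simpleT, Equiv.apply_symm_apply]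
      have hlo : ∀ x : Fin r, x.val = k ↔ x = loIdx s := fun x => by simp [Fin.ext_iff, loIdx, s]
      have hhi : ∀ x : Fin r, x.val = k + 1 ↔ x = hiIdx s := fun x => by
        simp [Fin.ext_iff, hiIdx, s]
      simp only [E]
      rw [Finset.sum_mul, Finset.smul_sum]
      symm
      refine Finset.sum_nbij' (fun w => w * simpleT s) (fun w => w * simpleT s) ?_ ?_ ?_ ?_ ?_
      · intro w hw
        rw [Finset.mem_filter, hhi] at hw
        rw [Finset.mem_filter, hlo, hsymm, hw.2, simpleT_hi_s7]
        exact ⟨hsP w hw.1, rfl⟩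
      · intro w hw
        rw [Finset.mem_filter, hlo] at hw
        rw [Finset.mem_filter, hhi, hsymm, hw.2, simpleT_lo_s7]
        exact ⟨hsP w hw.1, rfl⟩
      · intro w _
        rw [mul_assoc, hss, mul_one]
      · intro w _
        rw [mul_assoc, hss, mul_one]
      · intro w hw
        rw [Finset.mem_filter, hhi] at hw
        obtain ⟨hw1, hw2⟩ := hw
        have hwm : w (hiIdx s) = m := by rw [← hw2, Equiv.apply_symm_apply]
        have hlt : w (loIdx s) < w (hiIdx s) := by
          rw [hwm]
          have hne : w (loIdx s) ≠ m := by
            rw [← hwm]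
            intro h
            have := w.injective h
            simp [loIdx, hiIdx, Fin.ext_iff] at this
          by_contra hcon
          have hge : n + 1 ≤ (w (loIdx s)).val := by
            have h1 : (w (loIdx s)).val ≠ n := fun h => hne (Fin.ext h)
            have h2 : ¬ (w (loIdx s)).val < n := hcon
            omega
          have h3 := w.injective ((hP w).1 hw1 _ hge)
          rw [h3] at hge
          simp [loIdx, s] at hge
          omega
        have hl := len_mul w s hlt
        rw [hl, hTW.2 w s hl, Tn, dif_pos hkr, smul_mul_assoc, smul_smul, pow_succ']

end Comb

end HCPaper

open HCPaper in
/-- `y_{(r)} c'_{q,r} = c_{q,r} y_{(r)}` in the Hecke-Clifford superalgebra, where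
`y_{(r)} = ∑_w (-q⁻¹)^{ℓ(w)} T_w` and `q` is invertible. -/
theorem stmt7 (R : Type) [CommRing R] (h2 : ringChar R ≠ 2) (q : R) (hq : IsUnit q)
    (r : ℕ) (TW : Equiv.Perm (Fin r) → HC R q r) (hTW : IsTW q r TW) :
    (∑ w : Equiv.Perm (Fin r), (-(Ring.inverse q)) ^ (len w) • TW w) * cqr' R q r
      = cqr R q r * (∑ w : Equiv.Perm (Fin r), (-(Ring.inverse q)) ^ (len w) • TW w) := by
  have hpq : Ring.inverse q * q = 1 := Ring.inverse_mul_cancel q hq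
  have H := hrel (r := r) (Ring.inverse q) hpq
  have hY := Ysum (Ring.inverse q) TW hTW r le_rfl
  have hf : (Finset.univ.filter fun w : Equiv.Perm (Fin r) =>
      ∀ j : Fin r, r ≤ j.val → w j = j) = Finset.univ :=
    Finset.filter_true_of_mem fun w _ j hj => absurd j.isLt (by omega)
  rw [hf] at hY
  have hF := H.final r le_rfl
  rw [hY]
  have h1 : cqr' R q r = ∑ j ∈ Finset.range r, q ^ j • Cn R q r j := by
    rw [Finset.sum_range, cqr']
    refine Finset.sum_congr rfl fun j _ => ?_
    rw [Cn, dif_pos j.isLt]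
  have h3 : cqr R q r = Cs q (Cn R q r) r := by
    rw [Cs_sum, Finset.sum_range, cqr]
    refine Finset.sum_congr rfl fun j _ => ?_
    rw [Cn, dif_pos j.isLt]
  rw [h1, h3, hF]
end
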